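/- Fix a dark current λ > 0 and let C_P(E) denote the capacity of the average-intensity-constrained Poisson optical intensity channel with dark current λ. Then liminf_{E → 0⁺} C_P(E) / (E · log log(1/E)) ≥ 1. -/

import Mathlib

open MeasureTheory ProbabilityTheory Filter
open scoped Classical

/-- Kullback–Leibler divergence (natural logarithm), with value `⊤` when it is
not defined as a real number. -/
noncomputable def klDiv {α : Type*} [MeasurableSpace α] (μ ν : Measure α) : EReal :=
  if μ ≪ ν ∧ Integrable (fun x => Real.log (μ.rnDeriv ν x).toReal) μ
  then ((∫ x, Real.log (μ.rnDeriv ν x).toReal ∂μ : ℝ) : EReal)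
  else ⊤

/-- Mutual information between the input `X ~ μ` and the output `Y` of the Poisson
optical intensity channel with dark current `lam`: conditionally on `X = x`, the
output `Y : ℕ` is Poisson with mean `lam + x`; the mutual information is the KL
divergence between the joint law of `(X, Y)` and the product of its two marginals. -/
noncomputable def poissonMI (lam : ℝ) (μ : Measure ℝ) : EReal :=
  let joint : Measure (ℝ × ℕ) :=
    μ.bind (fun x => (Measure.dirac x).prod (poissonMeasure (Real.toNNReal (lam + x))))
  klDiv joint (joint.fst.prod joint.snd)

/-- Capacity of the average-intensity-constrained Poisson optical intensity channel
with dark current `lam`: the supremum of the mutual information over all probability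
measures on `ℝ` concentrated on `[0, ∞)` with mean at most `E`. -/
noncomputable def C_P (lam : ℝ) (E : ℝ) : EReal :=
  ⨆ (μ : Measure ℝ) (_ : IsProbabilityMeasure μ) (_ : μ (Set.Iio 0) = 0)
    (_ : ∫⁻ x, ENNReal.ofReal x ∂μ ≤ ENNReal.ofReal E), poissonMI lam μ

open scoped NNReal Nat ENNReal

/-- The kernel sending `x` to the Poisson law of mean `lam + x`. -/
noncomputable def poissonChannel (lam : ℝ) : Kernel ℝ ℕ where
  toFun x := poissonMeasure (Real.toNNReal (lam + x))
  measurable' := by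
    refine Measure.measurable_of_measurable_coe _ fun s hs => ?_
    simp_rw [poissonMeasure, Measure.sum_apply _ hs, Measure.smul_apply]
    refine Measurable.tsum fun n => ?_
    simp only [smul_eq_mul]
    refine Measurable.mul_const ?_ _
    fun_prop

instance (lam : ℝ) : IsMarkovKernel (poissonChannel lam) :=
  ⟨fun x => by change IsProbabilityMeasure (poissonMeasure _); infer_instance⟩

/-- The Poisson probability of `y` for the mean `lam + x`. -/
noncomputable def poissonWeight (lam x : ℝ) (y : ℕ) : ℝ :=
  Real.exp (-(lam + x)) * (lam + x) ^ y / y !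

lemma poissonWeight_pos {lam x : ℝ} (h : 0 < lam + x) (y : ℕ) : 0 < poissonWeight lam x y := by
  unfold poissonWeight
  positivity

lemma poissonChannel_singleton {lam x : ℝ} (h : 0 < lam + x) (y : ℕ) :
    poissonChannel lam x {y} = ENNReal.ofReal (poissonWeight lam x y) := by
  change poissonMeasure _ _ = _
  rw [poissonMeasure_singleton, Real.coe_toNNReal _ h.le, poissonWeight]

lemma integrable_poissonChannel_iff {lam x : ℝ} (h : 0 < lam + x) {f : ℕ → ℝ} :
    Integrable f (poissonChannel lam x) ↔ Summable fun y => poissonWeight lam x y * |f y| := by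
  change Integrable f (poissonMeasure _) ↔ _
  rw [integrable_poissonMeasure_iff, Real.coe_toNNReal _ h.le]
  rfl

lemma integral_poissonChannel {lam x : ℝ} (h : 0 < lam + x) (f : ℕ → ℝ) :
    ∫ y, f y ∂(poissonChannel lam x) = ∑' y, poissonWeight lam x y * f y := by
  change ∫ y, f y ∂(poissonMeasure _) = _
  rw [integral_poissonMeasure, Real.coe_toNNReal _ h.le]
  rfl

lemma hasSum_poissonWeight {lam x : ℝ} (h : 0 < lam + x) :
    HasSum (poissonWeight lam x) 1 := by
  have := hasSum_one_poissonMeasure (Real.toNNReal (lam + x))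
  rwa [Real.coe_toNNReal _ h.le] at this

lemma poissonWeight_succ_mul (lam x : ℝ) (y : ℕ) :
    poissonWeight lam x (y + 1) * ((y + 1 : ℕ) : ℝ) = (lam + x) * poissonWeight lam x y := by
  unfold poissonWeight
  rw [Nat.factorial_succ]
  push_cast
  have : (y ! : ℝ) ≠ 0 := by positivity
  field_simp
  ring

lemma hasSum_poissonWeight_mul {lam x : ℝ} (h : 0 < lam + x) :
    HasSum (fun y => poissonWeight lam x y * (y : ℝ)) (lam + x) := by
  rw [← hasSum_nat_add_iff' 1]
  simp only [poissonWeight_succ_mul]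
  simpa using (hasSum_poissonWeight h).mul_left (lam + x)

lemma hasSum_poissonWeight_mul_sq {lam x : ℝ} (h : 0 < lam + x) :
    HasSum (fun y => poissonWeight lam x y * (y : ℝ) ^ 2) ((lam + x) * (lam + x + 1)) := by
  rw [← hasSum_nat_add_iff' 1]
  have := ((hasSum_poissonWeight_mul h).add (hasSum_poissonWeight h)).mul_left (lam + x)
  convert! this using 1
  · ext y
    rw [sq, ← mul_assoc, poissonWeight_succ_mul]
    push_cast
    ring
  · simp

lemma integrable_natCast_poissonChannel {lam x : ℝ} (h : 0 < lam + x) :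
    Integrable (fun y : ℕ => (y : ℝ)) (poissonChannel lam x) := by
  rw [integrable_poissonChannel_iff h]
  simpa using (hasSum_poissonWeight_mul h).summable

lemma integral_natCast_poissonChannel {lam x : ℝ} (h : 0 < lam + x) :
    ∫ y : ℕ, (y : ℝ) ∂(poissonChannel lam x) = lam + x := by
  rw [integral_poissonChannel h, (hasSum_poissonWeight_mul h).tsum_eq]

lemma integrable_natCast_sq_poissonChannel {lam x : ℝ} (h : 0 < lam + x) :
    Integrable (fun y : ℕ => (y : ℝ) ^ 2) (poissonChannel lam x) := by
  rw [integrable_poissonChannel_iff h]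
  simpa using (hasSum_poissonWeight_mul_sq h).summable

lemma integral_natCast_sq_poissonChannel {lam x : ℝ} (h : 0 < lam + x) :
    ∫ y : ℕ, (y : ℝ) ^ 2 ∂(poissonChannel lam x) = (lam + x) * (lam + x + 1) := by
  rw [integral_poissonChannel h, (hasSum_poissonWeight_mul_sq h).tsum_eq]

/-- The joint law of input and output. -/
noncomputable def poissonJoint (lam : ℝ) (μ : Measure ℝ) : Measure (ℝ × ℕ) :=
  μ ⊗ₘ poissonChannel lam

/-- The output probability of `y`. -/
noncomputable def outputWeight (lam : ℝ) (μ : Measure ℝ) (y : ℕ) : ℝ :=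
  (poissonJoint lam μ).snd.real {y}

instance (lam : ℝ) (μ : Measure ℝ) [IsProbabilityMeasure μ] :
    IsProbabilityMeasure (poissonJoint lam μ) := by
  unfold poissonJoint
  infer_instance

lemma poissonJoint_snd_singleton (lam : ℝ) (μ : Measure ℝ) [IsProbabilityMeasure μ] (y : ℕ) :
    (poissonJoint lam μ).snd {y} = ∫⁻ x, poissonChannel lam x {y} ∂μ := by
  rw [Measure.snd_apply (measurableSet_singleton y), poissonJoint,
    Measure.compProd_apply (measurable_snd (measurableSet_singleton y))]
  rfl

lemma poissonJoint_eq_bind (lam : ℝ) (μ : Measure ℝ) [IsProbabilityMeasure μ] :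
    μ.bind (fun x => (Measure.dirac x).prod (poissonMeasure (Real.toNNReal (lam + x)))) =
      poissonJoint lam μ := by
  have hk : Measurable
      (fun x => (Measure.dirac x).prod (poissonMeasure (Real.toNNReal (lam + x)))) := by
    refine Measure.measurable_of_measurable_coe _ fun s hs => ?_
    have : ∀ x : ℝ, ((Measure.dirac x).prod (poissonMeasure (Real.toNNReal (lam + x)))) s =
        poissonChannel lam x (Prod.mk x ⁻¹' s) := by
      intro x
      rw [Measure.dirac_prod, Measure.map_apply measurable_prodMk_left hs]
      rfl
    simp_rw [this]
    exact Kernel.measurable_kernel_prodMk_left hs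
  ext s hs
  rw [Measure.bind_apply hs hk.aemeasurable, poissonJoint, Measure.compProd_apply hs]
  refine lintegral_congr fun x => ?_
  rw [Measure.dirac_prod, Measure.map_apply measurable_prodMk_left hs]
  rfl

section

variable {lam : ℝ} {μ : Measure ℝ}

lemma ae_nonneg_of_measure_Iio (h0 : μ (Set.Iio 0) = 0) : ∀ᵐ x ∂μ, 0 ≤ x := by
  rw [ae_iff]
  simpa [Set.Iio] using h0

lemma outputWeight_pos [IsProbabilityMeasure μ] (hlam : 0 < lam) (hμ : ∀ᵐ x ∂μ, 0 ≤ x) (y : ℕ) :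
    0 < outputWeight lam μ y := by
  refine ENNReal.toReal_pos ?_ (measure_ne_top _ _)
  rw [poissonJoint_snd_singleton]
  intro h
  rw [lintegral_eq_zero_iff (Kernel.measurable_coe _ (measurableSet_singleton y))] at h
  have : ∀ᵐ x ∂μ, False := by
    filter_upwards [h, hμ] with x hx hx0
    have h1 : 0 < lam + x := by linarith
    rw [poissonChannel_singleton h1] at hx
    have := poissonWeight_pos h1 y
    simp at hx
    linarith
  exact this.exists.elim fun _ h => h

lemma hasSum_outputWeight [IsProbabilityMeasure μ] : HasSum (outputWeight lam μ) 1 := by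
  have h := measure_iUnion (μ := (poissonJoint lam μ).snd) (f := fun y : ℕ => ({y} : Set ℕ))
    (fun i j hij => by simpa using hij) (fun y => measurableSet_singleton y)
  have hu : (⋃ y : ℕ, ({y} : Set ℕ)) = Set.univ := by ext; simp
  rw [hu, measure_univ] at h
  have := ENNReal.hasSum_toReal (f := fun y : ℕ => (poissonJoint lam μ).snd {y})
    (by rw [← h]; simp)
  rw [← ENNReal.tsum_toReal_eq fun y => measure_ne_top _ _, ← h] at this
  rwa [ENNReal.toReal_one] at this

lemma measurable_poissonWeight (y : ℕ) : Measurable fun x => poissonWeight lam x y := by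
  unfold poissonWeight
  fun_prop

/-- The density of the joint law with respect to the product of its marginals. -/
noncomputable def informationRatio (lam : ℝ) (μ : Measure ℝ) (z : ℝ × ℕ) : ℝ :=
  poissonWeight lam z.1 z.2 / outputWeight lam μ z.2

lemma measurable_informationRatio : Measurable (informationRatio lam μ) :=
  measurable_from_prod_countable_left fun y =>
    (measurable_poissonWeight y).div_const (outputWeight lam μ y)

lemma poissonJoint_eq_withDensity [IsProbabilityMeasure μ] (hlam : 0 < lam)
    (hμ : ∀ᵐ x ∂μ, 0 ≤ x) :
    poissonJoint lam μ = (μ.prod (poissonJoint lam μ).snd).withDensity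
      (fun z => ENNReal.ofReal (informationRatio lam μ z)) := by
  set ν := (poissonJoint lam μ).snd with hν
  have hm : Measurable (fun z : ℝ × ℕ => ENNReal.ofReal (informationRatio lam μ z)) :=
    measurable_informationRatio.ennreal_ofReal
  ext s hs
  rw [withDensity_apply _ hs, ← lintegral_indicator hs,
    lintegral_prod _ (hm.indicator hs).aemeasurable]
  conv_lhs => rw [poissonJoint, Measure.compProd_apply hs]
  refine lintegral_congr_ae ?_
  filter_upwards [hμ] with x hx
  have h1 : 0 < lam + x := by linarith
  have : poissonChannel lam x =
      ν.withDensity fun y => ENNReal.ofReal (informationRatio lam μ (x, y)) := by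
    refine Measure.ext_of_singleton fun y => ?_
    have hq := outputWeight_pos hlam hμ y
    rw [poissonChannel_singleton h1, withDensity_apply _ (measurableSet_singleton y),
      lintegral_singleton]
    have : ν {y} = ENNReal.ofReal (outputWeight lam μ y) := by
      rw [outputWeight, ofReal_measureReal]
    rw [this, ← ENNReal.ofReal_mul' hq.le, informationRatio, div_mul_cancel₀ _ hq.ne']
  rw [this, withDensity_apply _ (measurable_prodMk_left hs),
    ← lintegral_indicator (measurable_prodMk_left hs)]
  rfl

lemma ae_poissonJoint_fst_nonneg [IsProbabilityMeasure μ] (hμ : ∀ᵐ x ∂μ, 0 ≤ x) :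
    ∀ᵐ z ∂(poissonJoint lam μ), 0 ≤ z.1 := by
  rw [poissonJoint]
  exact Measure.ae_compProd_of_ae_fst _ measurableSet_Ici hμ

lemma poissonMI_eq [IsProbabilityMeasure μ] (hlam : 0 < lam) (hμ : ∀ᵐ x ∂μ, 0 ≤ x)
    (hint : Integrable (fun z => Real.log (informationRatio lam μ z)) (poissonJoint lam μ)) :
    poissonMI lam μ =
      ((∫ z, Real.log (informationRatio lam μ z) ∂(poissonJoint lam μ) : ℝ) : EReal) := by
  unfold poissonMI
  simp only [poissonJoint_eq_bind]
  have hfst : (poissonJoint lam μ).fst = μ := by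
    rw [poissonJoint, Measure.fst_compProd]
  rw [hfst]
  have hd := poissonJoint_eq_withDensity hlam hμ
  have hac : poissonJoint lam μ ≪ μ.prod (poissonJoint lam μ).snd := by
    conv_lhs => rw [hd]
    exact withDensity_absolutelyContinuous _ _
  have hrn : (poissonJoint lam μ).rnDeriv (μ.prod (poissonJoint lam μ).snd)
      =ᵐ[μ.prod (poissonJoint lam μ).snd]
      fun z => ENNReal.ofReal (informationRatio lam μ z) := by
    have := Measure.rnDeriv_withDensity (μ.prod (poissonJoint lam μ).snd)
      (measurable_informationRatio (lam := lam) (μ := μ)).ennreal_ofReal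
    rwa [← hd] at this
  have hlog : (fun z => Real.log
      ((poissonJoint lam μ).rnDeriv (μ.prod (poissonJoint lam μ).snd) z).toReal)
      =ᵐ[poissonJoint lam μ] fun z => Real.log (informationRatio lam μ z) := by
    filter_upwards [hac.ae_le hrn, ae_poissonJoint_fst_nonneg hμ] with z hz hz0
    have h1 : 0 < lam + z.1 := by linarith
    rw [hz, ENNReal.toReal_ofReal]
    exact (div_pos (poissonWeight_pos h1 _) (outputWeight_pos hlam hμ _)).le
  rw [klDiv, if_pos ⟨hac, hint.congr hlog.symm⟩, integral_congr_ae hlog]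

lemma integrable_inv_informationRatio [IsProbabilityMeasure μ] (hlam : 0 < lam)
    (hμ : ∀ᵐ x ∂μ, 0 ≤ x) :
    Integrable (fun z => (informationRatio lam μ z)⁻¹) (poissonJoint lam μ) := by
  have hsum : ∀ x, 0 ≤ x →
      (fun y => poissonWeight lam x y * |(informationRatio lam μ (x, y))⁻¹|) =
        outputWeight lam μ := by
    intro x hx
    ext y
    have hw := poissonWeight_pos (lam := lam) (x := x) (by linarith) y
    have hq := outputWeight_pos hlam hμ y
    rw [informationRatio, abs_of_pos (inv_pos.2 (div_pos hw hq))]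
    field_simp
  have hm : AEStronglyMeasurable (fun z => (informationRatio lam μ z)⁻¹)
      (μ ⊗ₘ poissonChannel lam) :=
    measurable_informationRatio.inv.aestronglyMeasurable
  rw [poissonJoint, Measure.integrable_compProd_iff hm]
  constructor
  · filter_upwards [hμ] with x hx
    rw [integrable_poissonChannel_iff (by linarith), hsum x hx]
    exact hasSum_outputWeight.summable
  · refine (integrable_const (1 : ℝ)).congr ?_
    filter_upwards [hμ] with x hx
    simp only [Real.norm_eq_abs]
    rw [integral_poissonChannel (by linarith), hsum x hx, hasSum_outputWeight.tsum_eq]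

lemma integrable_div_outputWeight [IsProbabilityMeasure μ] (hlam : 0 < lam)
    (hμ : ∀ᵐ x ∂μ, 0 ≤ x) {R : ℕ → ℝ} {S : ℝ} (hR : ∀ y, 0 < R y) (hS : HasSum R S) :
    Integrable (fun z => R z.2 / outputWeight lam μ z.2) (poissonJoint lam μ) ∧
      ∫ z, R z.2 / outputWeight lam μ z.2 ∂(poissonJoint lam μ) = S := by
  have hq := outputWeight_pos hlam hμ
  have hi : Integrable (fun y => R y / outputWeight lam μ y) (poissonJoint lam μ).snd := by
    refine ⟨Measurable.of_discrete.aestronglyMeasurable, ?_⟩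
    rw [hasFiniteIntegral_iff_ofReal (ae_of_all _ fun y => (div_pos (hR y) (hq y)).le),
      lintegral_countable']
    have : ∀ y, ENNReal.ofReal (R y / outputWeight lam μ y) * (poissonJoint lam μ).snd {y} =
        ENNReal.ofReal (R y) := by
      intro y
      have : (poissonJoint lam μ).snd {y} = ENNReal.ofReal (outputWeight lam μ y) := by
        rw [outputWeight, ofReal_measureReal]
      rw [this, ← ENNReal.ofReal_mul' (hq y).le, div_mul_cancel₀ _ (hq y).ne']
    simp_rw [this]
    exact hS.summable.tsum_ofReal_lt_top
  have hv : ∫ y, R y / outputWeight lam μ y ∂(poissonJoint lam μ).snd = S := by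
    rw [integral_countable hi, ← hS.tsum_eq]
    refine tsum_congr fun y => ?_
    rw [smul_eq_mul]
    exact mul_div_cancel₀ _ (hq y).ne'
  rw [Measure.snd] at hi hv
  refine ⟨hi.comp_measurable measurable_snd, ?_⟩
  rw [← hv, integral_map measurable_snd.aemeasurable hi.aestronglyMeasurable]

/-- The duality bound: any positive weight `R` on the outputs bounds the mutual information. -/
lemma integrable_log_informationRatio_and_le [IsProbabilityMeasure μ] (hlam : 0 < lam)
    (hμ : ∀ᵐ x ∂μ, 0 ≤ x) {R : ℕ → ℝ} {S : ℝ} (hR : ∀ y, 0 < R y) (hS : HasSum R S)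
    {h : ℝ × ℕ → ℝ} (hh : Integrable h (poissonJoint lam μ))
    (hle : ∀ x, 0 ≤ x → ∀ y, Real.log (poissonWeight lam x y / R y) ≤ h (x, y)) :
    Integrable (fun z => Real.log (informationRatio lam μ z)) (poissonJoint lam μ) ∧
      ∫ z, Real.log (informationRatio lam μ z) ∂(poissonJoint lam μ) ≤
        ∫ z, h z ∂(poissonJoint lam μ) + (S - 1) := by
  obtain ⟨hRi, hRv⟩ := integrable_div_outputWeight hlam hμ hR hS
  have hq := outputWeight_pos hlam hμ
  have hup : ∀ᵐ z ∂(poissonJoint lam μ), Real.log (informationRatio lam μ z) ≤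
      h z + (R z.2 / outputWeight lam μ z.2 - 1) := by
    filter_upwards [ae_poissonJoint_fst_nonneg hμ] with z hz
    have hw := poissonWeight_pos (lam := lam) (x := z.1) (by linarith) z.2
    have hq := hq z.2
    have hR := hR z.2
    have : informationRatio lam μ z =
        (poissonWeight lam z.1 z.2 / R z.2) * (R z.2 / outputWeight lam μ z.2) := by
      rw [informationRatio]
      field_simp
    rw [this, Real.log_mul (by positivity) (by positivity)]
    exact add_le_add (hle z.1 hz z.2) (Real.log_le_sub_one_of_pos (by positivity))
  have hlow : ∀ᵐ z ∂(poissonJoint lam μ), 1 - (informationRatio lam μ z)⁻¹ ≤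
      Real.log (informationRatio lam μ z) := by
    filter_upwards [ae_poissonJoint_fst_nonneg hμ] with z hz
    have hw := poissonWeight_pos (lam := lam) (x := z.1) (by linarith) z.2
    exact Real.one_sub_inv_le_log_of_pos (div_pos hw (hq z.2))
  have hupi := hh.add (hRi.sub (integrable_const 1))
  have hint : Integrable (fun z => Real.log (informationRatio lam μ z)) (poissonJoint lam μ) :=
    integrable_of_le_of_le measurable_informationRatio.log.aestronglyMeasurable hlow hup
      ((integrable_const 1).sub (integrable_inv_informationRatio hlam hμ)) hupi
  refine ⟨hint, (integral_mono_ae hint hupi hup).trans_eq ?_⟩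
  have h1 := integral_add hh (hRi.sub (integrable_const (1 : ℝ)))
  have h2 := integral_sub hRi (integrable_const (1 : ℝ) (μ := poissonJoint lam μ))
  simp only [Pi.add_apply, Pi.sub_apply] at h1 h2 ⊢
  rw [h1, h2, hRv]
  simp

/-- Integration of functions that are affine in the output. -/
lemma integral_affine_poissonJoint [IsProbabilityMeasure μ] (hlam : 0 < lam)
    (hμ : ∀ᵐ x ∂μ, 0 ≤ x) (hid : Integrable (fun x => x) μ) {a b : ℝ → ℝ} {B : ℝ}
    (ha : Integrable a μ) (hb : Measurable b) (hB : ∀ᵐ x ∂μ, |b x| ≤ B) :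
    Integrable (fun z : ℝ × ℕ => a z.1 + b z.1 * z.2) (poissonJoint lam μ) ∧
      ∫ z, (a z.1 + b z.1 * z.2) ∂(poissonJoint lam μ) =
        ∫ x, (a x + b x * (lam + x)) ∂μ := by
  have hfst : (poissonJoint lam μ).map Prod.fst = μ := by
    rw [poissonJoint]
    exact Measure.fst_compProd _ _
  have h1 : Integrable (fun z : ℝ × ℕ => a z.1) (poissonJoint lam μ) := by
    rw [← hfst] at ha
    exact ha.comp_measurable measurable_fst
  have hn : Measurable fun z : ℝ × ℕ => (z.2 : ℝ) := by fun_prop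
  have hy : Integrable (fun z : ℝ × ℕ => (z.2 : ℝ)) (poissonJoint lam μ) := by
    rw [poissonJoint, Measure.integrable_compProd_iff hn.aestronglyMeasurable]
    constructor
    · filter_upwards [hμ] with x hx
      exact integrable_natCast_poissonChannel (by linarith)
    · refine ((integrable_const lam).add hid).congr ?_
      filter_upwards [hμ] with x hx
      simp only [Pi.add_apply, Real.norm_natCast]
      rw [integral_natCast_poissonChannel (by linarith)]
  have h2 : Integrable (fun z : ℝ × ℕ => b z.1 * z.2) (poissonJoint lam μ) := by
    refine hy.bdd_mul (c := B) (hb.comp measurable_fst).aestronglyMeasurable ?_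
    rw [poissonJoint]
    exact Measure.ae_compProd_of_ae_fst _ (measurableSet_le hb.norm measurable_const) hB
  have h3 := h1.add h2
  refine ⟨h3, ?_⟩
  have h4 : Integrable (fun z : ℝ × ℕ => a z.1 + b z.1 * z.2) (μ ⊗ₘ poissonChannel lam) := h3
  rw [poissonJoint, Measure.integral_compProd h4]
  refine integral_congr_ae ?_
  filter_upwards [hμ] with x hx
  have hp : 0 < lam + x := by linarith
  rw [integral_add (integrable_const _) ((integrable_natCast_poissonChannel hp).const_mul _),
    integral_const_mul, integral_natCast_poissonChannel hp]
  simp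

lemma poissonWeight_eq_mul (hlam : 0 < lam) (x : ℝ) (y : ℕ) :
    poissonWeight lam x y =
      poissonWeight lam 0 y * (Real.exp (-x) * ((lam + x) / lam) ^ y) := by
  unfold poissonWeight
  rw [neg_add, Real.exp_add, div_pow, add_zero]
  field_simp

lemma integrable_id_and_integral_le {E : ℝ} (hE : 0 ≤ E) (hμ : ∀ᵐ x ∂μ, 0 ≤ x)
    (hm : ∫⁻ x, ENNReal.ofReal x ∂μ ≤ ENNReal.ofReal E) :
    Integrable (fun x => x) μ ∧ ∫ x, x ∂μ ≤ E := by
  have hi : Integrable (fun x : ℝ => x) μ := by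
    refine ⟨measurable_id.aestronglyMeasurable, ?_⟩
    rw [hasFiniteIntegral_iff_ofReal hμ]
    exact hm.trans_lt ENNReal.ofReal_lt_top
  refine ⟨hi, ?_⟩
  rwa [← ofReal_integral_eq_lintegral_ofReal hi hμ, ENNReal.ofReal_le_ofReal_iff hE] at hm

/-- Duality with the output weights `Po(lam) + E * Geometric(1/2)`. -/
lemma integrable_log_informationRatio_and_le_of_mean [IsProbabilityMeasure μ] (hlam : 0 < lam)
    (hμ : ∀ᵐ x ∂μ, 0 ≤ x) {E : ℝ} (hE : 0 < E) (hE1 : 1 ≤ Real.log (1 / E))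
    (hm : ∫⁻ x, ENNReal.ofReal x ∂μ ≤ ENNReal.ofReal E) :
    Integrable (fun z => Real.log (informationRatio lam μ z)) (poissonJoint lam μ) ∧
      ∫ z, Real.log (informationRatio lam μ z) ∂(poissonJoint lam μ) ≤
        (Real.log ((lam + Real.log (1 / E)) / lam) + lam + 4) * E := by
  obtain ⟨hid, hmean⟩ := integrable_id_and_integral_le hE.le hμ hm
  set T := Real.log (1 / E) with hT
  have hlog2 : 0 < Real.log 2 := Real.log_pos (by norm_num)
  have hlog2' : Real.log 2 ≤ 1 / 2 + 1 / 2 := by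
    linarith [Real.log_le_sub_one_of_pos (show (0 : ℝ) < 2 by norm_num)]
  set a : ℝ → ℝ := fun x => if x ≤ T then -x else T + Real.log 2 with ha
  set b : ℝ → ℝ := fun x => if x ≤ T then Real.log ((lam + x) / lam) else Real.log 2 with hb
  have hma : Measurable a := Measurable.ite measurableSet_Iic (by fun_prop) (by fun_prop)
  have hmb : Measurable b := Measurable.ite measurableSet_Iic (by fun_prop) (by fun_prop)
  have hlogmono : ∀ x, 0 ≤ x → x ≤ T →
      0 ≤ Real.log ((lam + x) / lam) ∧
        Real.log ((lam + x) / lam) ≤ Real.log ((lam + T) / lam) := by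
    intro x hx hxT
    constructor
    · exact Real.log_nonneg (by rw [le_div_iff₀ hlam]; linarith)
    · exact Real.log_le_log (by positivity) (by gcongr)
  have hLT := (hlogmono T (by linarith) le_rfl).1
  have hai : Integrable a μ := by
    refine (hid.norm.add (integrable_const (T + Real.log 2))).mono' hma.aestronglyMeasurable
      (ae_of_all _ fun x => ?_)
    simp only [ha, Pi.add_apply]
    split_ifs
    · rw [norm_neg]
      linarith
    · rw [Real.norm_of_nonneg (by linarith)]
      linarith [norm_nonneg x]
  have hB : ∀ᵐ x ∂μ, |b x| ≤ Real.log ((lam + T) / lam) + Real.log 2 := by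
    filter_upwards [hμ] with x hx
    simp only [hb]
    split_ifs with hxT
    · have := hlogmono x hx hxT
      rw [abs_of_nonneg this.1]
      linarith
    · rw [abs_of_pos hlog2]
      linarith
  obtain ⟨hh, hv⟩ := integral_affine_poissonJoint hlam hμ hid hai hmb hB
  have hw0 : ∀ y, 0 < poissonWeight lam 0 y := poissonWeight_pos (by linarith)
  have hR : ∀ y : ℕ, 0 < poissonWeight lam 0 y + E / 2 / 2 ^ y := fun y => by
    have := hw0 y
    positivity
  have hS : HasSum (fun y : ℕ => poissonWeight lam 0 y + E / 2 / 2 ^ y) (1 + E) :=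
    (hasSum_poissonWeight (by linarith)).add (hasSum_geometric_two' E)
  obtain ⟨hi, hle⟩ := integrable_log_informationRatio_and_le hlam hμ hR hS hh (by
    intro x hx y
    have hxp : 0 < lam + x := by linarith
    have hw := poissonWeight_pos hxp y
    simp only [ha, hb]
    split_ifs with hxT
    · have : poissonWeight lam x y / (poissonWeight lam 0 y + E / 2 / 2 ^ y) ≤
          Real.exp (-x) * ((lam + x) / lam) ^ y := by
        rw [div_le_iff₀ (hR y), poissonWeight_eq_mul hlam x y, mul_comm]
        gcongr
        exact le_add_of_nonneg_right (by positivity)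
      refine (Real.log_le_log (div_pos hw (hR y)) this).trans_eq ?_
      rw [Real.log_mul (by positivity) (by positivity), Real.log_exp, Real.log_pow]
      ring
    · have hw1 : poissonWeight lam x y ≤ 1 :=
        le_hasSum (hasSum_poissonWeight hxp) y fun z _ => (poissonWeight_pos hxp z).le
      have : poissonWeight lam x y / (poissonWeight lam 0 y + E / 2 / 2 ^ y) ≤
          1 / E * (2 * 2 ^ y) := by
        refine (div_le_div₀ zero_le_one hw1 (by positivity)
          (le_add_of_nonneg_left (hw0 y).le)).trans_eq ?_
        field_simp
      refine (Real.log_le_log (div_pos hw (hR y)) this).trans_eq ?_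
      rw [Real.log_mul (by positivity) (by positivity), Real.log_mul (by positivity)
        (by positivity), Real.log_pow]
      ring)
  refine ⟨hi, hle.trans ?_⟩
  rw [hv]
  have hbound : ∀ᵐ x ∂μ, a x + b x * (lam + x) ≤
      (Real.log ((lam + T) / lam) + lam + 3) * x := by
    filter_upwards [hμ] with x hx
    simp only [ha, hb]
    split_ifs with hxT
    · have h1 := hlogmono x hx hxT
      have h2 : lam * Real.log ((lam + x) / lam) ≤ x := by
        have := Real.log_le_sub_one_of_pos (show 0 < (lam + x) / lam by positivity)
        calc lam * Real.log ((lam + x) / lam) ≤ lam * ((lam + x) / lam - 1) := by gcongr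
          _ = x := by field_simp; ring
      nlinarith [mul_le_mul_of_nonneg_right h1.2 hx]
    · push Not at hxT
      have hxp_nonneg : 0 ≤ lam + x := by linarith
      nlinarith [mul_le_mul_of_nonneg_right hlog2' hxp_nonneg, mul_nonneg hLT hx]
  have hai2 : Integrable (fun x => a x + b x * (lam + x)) μ :=
    hai.add (((integrable_const lam).add hid).bdd_mul hmb.aestronglyMeasurable hB)
  have := integral_mono_ae hai2 (hid.const_mul _) hbound
  rw [integral_const_mul] at this
  have hM : 0 ≤ Real.log ((lam + T) / lam) + lam + 3 := by linarith
  nlinarith [mul_le_mul_of_nonneg_left hmean hM]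

/-- Low-intensity upper bound on the capacity. -/
lemma C_P_le (hlam : 0 < lam) {E : ℝ} (hE : 0 < E) (hE1 : 1 ≤ Real.log (1 / E)) :
    C_P lam E ≤
      (((Real.log ((lam + Real.log (1 / E)) / lam) + lam + 4) * E : ℝ) : EReal) := by
  refine iSup_le fun μ => iSup_le fun hp => iSup_le fun h0 => iSup_le fun hm => ?_
  have hμ := ae_nonneg_of_measure_Iio h0
  obtain ⟨hi, hle⟩ := integrable_log_informationRatio_and_le_of_mean hlam hμ hE hE1 hm
  rw [poissonMI_eq hlam hμ hi]
  exact_mod_cast hle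

/-- The two-point input law taking the value `A` with probability `p` and `0` otherwise. -/
noncomputable def onOffLaw (p A : ℝ) : Measure ℝ :=
  ENNReal.ofReal (1 - p) • Measure.dirac 0 + ENNReal.ofReal p • Measure.dirac A

lemma isProbabilityMeasure_onOffLaw {p A : ℝ} (hp : 0 ≤ p) (hp1 : p ≤ 1) :
    IsProbabilityMeasure (onOffLaw p A) := by
  refine ⟨?_⟩
  simp only [onOffLaw, Measure.add_apply, Measure.smul_apply, measure_univ, smul_eq_mul, mul_one]
  rw [← ENNReal.ofReal_add (by linarith) hp]
  simp

lemma ae_onOffLaw_iff {p A : ℝ} (hp : 0 < p) (hp1 : p < 1) {P : ℝ → Prop} :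
    (∀ᵐ x ∂(onOffLaw p A), P x) ↔ P 0 ∧ P A := by
  rw [onOffLaw, ae_add_measure_iff, Measure.ae_ennreal_smul_measure_iff (by simpa using hp1),
    Measure.ae_ennreal_smul_measure_iff (by simpa using hp), ae_dirac_eq, ae_dirac_eq]
  simp

lemma lintegral_onOffLaw {p A : ℝ} (f : ℝ → ℝ≥0∞) :
    ∫⁻ x, f x ∂(onOffLaw p A) = ENNReal.ofReal (1 - p) * f 0 + ENNReal.ofReal p * f A := by
  simp [onOffLaw]

lemma integral_onOffLaw {p A : ℝ} (hp : 0 ≤ p) (hp1 : p ≤ 1) (f : ℝ → ℝ) :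
    ∫ x, f x ∂(onOffLaw p A) = (1 - p) * f 0 + p * f A := by
  have h : ∀ a : ℝ, Integrable f (Measure.dirac a) := fun a => integrable_dirac (by simp)
  rw [onOffLaw, integral_add_measure ((h 0).smul_measure ENNReal.ofReal_ne_top)
    ((h A).smul_measure ENNReal.ofReal_ne_top), integral_smul_measure, integral_smul_measure,
    integral_dirac, integral_dirac, ENNReal.toReal_ofReal (by linarith),
    ENNReal.toReal_ofReal hp, smul_eq_mul, smul_eq_mul]

lemma outputWeight_onOffLaw (hlam : 0 < lam) {p A : ℝ} (hp : 0 < p) (hp1 : p < 1) (hA : 0 < A)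
    (y : ℕ) :
    outputWeight lam (onOffLaw p A) y =
      (1 - p) * poissonWeight lam 0 y + p * poissonWeight lam A y := by
  have := isProbabilityMeasure_onOffLaw (A := A) hp.le hp1.le
  have h0 := poissonWeight_pos (lam := lam) (x := 0) (by linarith) y
  have h1 := poissonWeight_pos (lam := lam) (x := A) (by linarith) y
  have hp1' : 0 ≤ 1 - p := by linarith
  rw [outputWeight, measureReal_def, poissonJoint_snd_singleton, lintegral_onOffLaw,
    poissonChannel_singleton (by linarith), poissonChannel_singleton (by linarith),
    ← ENNReal.ofReal_mul hp1', ← ENNReal.ofReal_mul hp.le,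
    ← ENNReal.ofReal_add (by positivity) (by positivity), ENNReal.toReal_ofReal (by positivity)]

lemma one_add_exp_sub_le {u v : ℝ} (hu : 0 ≤ u) (hv : 0 < v) :
    1 + Real.exp (u - v) ≤ 2 * Real.exp (u ^ 2 / v) := by
  have h1 : u - v ≤ u ^ 2 / v := by
    rw [le_div_iff₀ hv]
    nlinarith [sq_nonneg (u - v), mul_nonneg hu hv.le]
  have h2 := Real.exp_le_exp.2 h1
  have h3 : 1 ≤ Real.exp (u ^ 2 / v) := Real.one_le_exp (by positivity)
  linarith

/-- On-off keying lower bound on the capacity. -/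
lemma le_toReal_C_P (hlam : 0 < lam) {E p A : ℝ} (hE : 0 < E) (hE1 : 1 ≤ Real.log (1 / E))
    (hp : 0 < p) (hp1 : p < 1) (hA : 0 < A) (hpA : p * A = E) :
    p * (-A + (lam + A) * Real.log ((lam + A) / lam) - Real.log 2 -
      Real.log ((lam + A) / lam) ^ 2 / Real.log (1 / p) * ((lam + A) * (lam + A + 1))) ≤
      (C_P lam E).toReal := by
  set L := Real.log ((lam + A) / lam) with hL
  set v := Real.log (1 / p) with hv
  have hv0 : 0 < v := Real.log_pos (by rw [lt_div_iff₀ hp]; linarith)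
  have hL0 : 0 ≤ L := Real.log_nonneg (by rw [le_div_iff₀ hlam]; linarith)
  have hprob := isProbabilityMeasure_onOffLaw (A := A) hp.le hp1.le
  have hμ : ∀ᵐ x ∂(onOffLaw p A), 0 ≤ x := (ae_onOffLaw_iff hp hp1).2 ⟨le_rfl, hA.le⟩
  have h0 : onOffLaw p A (Set.Iio 0) = 0 := by
    rw [ae_iff] at hμ
    simpa [Set.Iio] using hμ
  have hm : ∫⁻ x, ENNReal.ofReal x ∂(onOffLaw p A) ≤ ENNReal.ofReal E := by
    rw [lintegral_onOffLaw, ← hpA, ENNReal.ofReal_mul hp.le]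
    simp
  obtain ⟨hi, -⟩ := integrable_log_informationRatio_and_le_of_mean hlam hμ hE hE1 hm
  have hle : poissonMI lam (onOffLaw p A) ≤ C_P lam E :=
    le_iSup_of_le (onOffLaw p A) <| le_iSup_of_le hprob <| le_iSup_of_le h0 <|
      le_iSup_of_le hm le_rfl
  rw [poissonMI_eq hlam hμ hi] at hle
  have htop : C_P lam E ≠ ⊤ := ((C_P_le hlam hE hE1).trans_lt (EReal.coe_lt_top _)).ne
  have hreal := EReal.toReal_le_toReal hle (EReal.coe_ne_bot _) htop
  rw [EReal.toReal_coe] at hreal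
  refine le_trans ?_ hreal
  have hi' : Integrable (fun z => Real.log (informationRatio lam (onOffLaw p A) z))
    (onOffLaw p A ⊗ₘ poissonChannel lam) := hi
  have hsec := (ae_onOffLaw_iff hp hp1).1
    ((Measure.integrable_compProd_iff hi'.aestronglyMeasurable).1 hi').1
  rw [poissonJoint, Measure.integral_compProd hi', integral_onOffLaw hp.le hp1.le]
  have hq := outputWeight_pos hlam hμ
  have hlam0 : 0 < lam + 0 := by linarith
  have hlamA : 0 < lam + A := by linarith
  have hoff : 0 ≤ ∫ y, Real.log (informationRatio lam (onOffLaw p A) (0, y))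
      ∂(poissonChannel lam 0) := by
    have heq : ∀ y, poissonWeight lam 0 y * (informationRatio lam (onOffLaw p A) (0, y))⁻¹ =
        outputWeight lam (onOffLaw p A) y := by
      intro y
      have := poissonWeight_pos hlam0 y
      rw [informationRatio]
      field_simp
    have hpos : ∀ y, 0 < informationRatio lam (onOffLaw p A) (0, y) :=
      fun y => div_pos (poissonWeight_pos hlam0 y) (hq y)
    have hinv : Integrable (fun y => (informationRatio lam (onOffLaw p A) (0, y))⁻¹)
        (poissonChannel lam 0) := by
      rw [integrable_poissonChannel_iff hlam0]
      simp_rw [abs_of_pos (inv_pos.2 (hpos _)), heq]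
      exact hasSum_outputWeight.summable
    have := integral_mono ((integrable_const (1 : ℝ)).sub hinv) hsec.1
      fun y => Real.one_sub_inv_le_log_of_pos (hpos y)
    refine le_trans (le_of_eq ?_) this
    have h2 := integral_sub (integrable_const (1 : ℝ)) hinv
    simp only [Pi.sub_apply]
    rw [h2, integral_poissonChannel hlam0 fun y =>
      (informationRatio lam (onOffLaw p A) (0, y))⁻¹]
    simp_rw [heq]
    rw [hasSum_outputWeight.tsum_eq]
    simp
  have hon : -A + (lam + A) * L - Real.log 2 - L ^ 2 / v * ((lam + A) * (lam + A + 1)) ≤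
      ∫ y, Real.log (informationRatio lam (onOffLaw p A) (A, y)) ∂(poissonChannel lam A) := by
    have hpt : ∀ y : ℕ, (-A - Real.log 2) + L * y - L ^ 2 / v * (y : ℝ) ^ 2 ≤
        Real.log (informationRatio lam (onOffLaw p A) (A, y)) := by
      intro y
      have hw0 := poissonWeight_pos hlam0 y
      have hu : 0 ≤ L * y := by positivity
      have hr : ((lam + A) / lam) ^ y = Real.exp (L * y) := by
        rw [mul_comm, Real.exp_nat_mul, hL, Real.exp_log (by positivity)]
      have hwA : poissonWeight lam A y =
          poissonWeight lam 0 y * (Real.exp (-A) * Real.exp (L * y)) := by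
        rw [poissonWeight_eq_mul hlam, hr]
      have hpv : p = Real.exp (-v) := by
        rw [hv, one_div, Real.log_inv, neg_neg, Real.exp_log hp]
      have hqle : outputWeight lam (onOffLaw p A) y ≤
          poissonWeight lam 0 y * (2 * Real.exp ((L * y) ^ 2 / v)) := by
        refine le_trans ?_ (mul_le_mul_of_nonneg_left (one_add_exp_sub_le hu hv0) hw0.le)
        rw [outputWeight_onOffLaw hlam hp hp1 hA, hwA, mul_add, mul_one]
        refine add_le_add ?_ ?_
        · nlinarith
        · have h3 : Real.exp (-A) ≤ 1 := Real.exp_le_one_iff.2 (by linarith)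
          rw [sub_eq_add_neg, Real.exp_add, ← hpv]
          calc p * (poissonWeight lam 0 y * (Real.exp (-A) * Real.exp (L * y))) ≤
              p * (poissonWeight lam 0 y * (1 * Real.exp (L * y))) := by gcongr
            _ = _ := by ring
      have hlow : Real.exp (-A) * Real.exp (L * y) / (2 * Real.exp ((L * y) ^ 2 / v)) ≤
          informationRatio lam (onOffLaw p A) (A, y) := by
        rw [informationRatio, le_div_iff₀ (hq y), hwA]
        refine (mul_le_mul_of_nonneg_left hqle (by positivity)).trans_eq ?_
        field_simp
      refine le_trans (le_of_eq ?_) (Real.log_le_log (by positivity) hlow)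
      rw [Real.log_div (by positivity) (by positivity), Real.log_mul (by positivity)
        (by positivity), Real.log_mul (by positivity) (by positivity), Real.log_exp,
        Real.log_exp, Real.log_exp]
      ring
    have i1 := (integrable_natCast_poissonChannel hlamA).const_mul L
    have i2 := (integrable_natCast_sq_poissonChannel hlamA).const_mul (L ^ 2 / v)
    have i0 := (integrable_const (-A - Real.log 2) (μ := poissonChannel lam A))
    refine le_trans (le_of_eq ?_) (integral_mono ((i0.add i1).sub i2) hsec.2 hpt)
    rw [integral_sub' (i0.add i1) i2, integral_add' i0 i1, integral_const_mul,
      integral_const_mul, integral_natCast_poissonChannel hlamA,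
      integral_natCast_sq_poissonChannel hlamA]
    simp
    ring
  have h1p : 0 ≤ 1 - p := by linarith
  have := mul_nonneg h1p hoff
  have := mul_le_mul_of_nonneg_left hon hp.le
  linarith

lemma eventually_le_onOff_rate (hlam : 0 < lam) {ε : ℝ} (hε : 0 < ε) (hε1 : ε < 1) :
    ∀ᶠ t : ℝ in atTop, 1 ≤ t ^ (1 - ε) ∧ ∀ v, t ≤ v →
      t ^ (1 - ε) * ((1 - 2 * ε) * Real.log t) ≤
        -t ^ (1 - ε) + (lam + t ^ (1 - ε)) * Real.log ((lam + t ^ (1 - ε)) / lam) - Real.log 2 -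
          Real.log ((lam + t ^ (1 - ε)) / lam) ^ 2 / v *
            ((lam + t ^ (1 - ε)) * (lam + t ^ (1 - ε) + 1)) := by
  have hlittle : ∀ᶠ t : ℝ in atTop, 24 * Real.log t ^ 2 ≤ t ^ ε := by
    have := (isLittleO_log_rpow_rpow_atTop 2 hε).bound (show (0 : ℝ) < 1 / 24 by norm_num)
    filter_upwards [this, eventually_ge_atTop 1] with t ht ht1
    have hlog := Real.log_nonneg ht1
    rw [Real.norm_of_nonneg (by positivity), Real.norm_of_nonneg (by positivity),
      Real.rpow_two] at ht
    linarith
  have hA := tendsto_rpow_atTop (show 0 < 1 - ε by linarith)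
  filter_upwards [hlittle, hA.eventually_ge_atTop 1, hA.eventually_ge_atTop lam,
    eventually_ge_atTop (2 / lam), eventually_ge_atTop 1,
    Real.tendsto_log_atTop.eventually_ge_atTop ((Real.log lam + 3) / ε)]
    with t hlit hA1 hAlam ht2 ht1 hlog
  refine ⟨hA1, fun v hv => ?_⟩
  have ht0 : 0 < t := by linarith
  have hlt : 0 ≤ Real.log t := Real.log_nonneg ht1
  have hlogA : Real.log (t ^ (1 - ε)) = (1 - ε) * Real.log t := Real.log_rpow ht0 _
  have hAt : t ^ (1 - ε) ≤ t := by
    simpa using Real.rpow_le_rpow_of_exponent_le ht1 (show 1 - ε ≤ 1 by linarith)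
  have hmul : t ^ ε * t ^ (1 - ε) = t := by
    rw [← Real.rpow_add ht0]
    simp
  set A := t ^ (1 - ε) with hAdef
  set L := Real.log ((lam + A) / lam) with hL
  have hA0 : 0 < A := by linarith
  have hL0 : 0 ≤ L := Real.log_nonneg (by rw [le_div_iff₀ hlam]; linarith)
  have hLlow : (1 - ε) * Real.log t - Real.log lam ≤ L := by
    rw [← hlogA, ← Real.log_div hA0.ne' hlam.ne']
    exact Real.log_le_log (by positivity) (by gcongr; linarith)
  have hLup : L ≤ 2 * Real.log t := by
    have : (2 : ℝ) * Real.log t = Real.log (t * t) := by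
      rw [Real.log_mul ht0.ne' ht0.ne']
      ring
    rw [this]
    refine Real.log_le_log (by positivity) ?_
    calc (lam + A) / lam ≤ (2 * A) / lam := by gcongr; linarith
      _ = 2 / lam * A := by ring
      _ ≤ t * t := by gcongr
  have hquad : L ^ 2 / v * ((lam + A) * (lam + A + 1)) ≤ A := by
    calc L ^ 2 / v * ((lam + A) * (lam + A + 1))
        ≤ (2 * Real.log t) ^ 2 / t * ((2 * A) * (3 * A)) := by
          gcongr <;> linarith
      _ = (24 * Real.log t ^ 2) * A * A / t := by ring
      _ ≤ t ^ ε * A * A / t := by gcongr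
      _ = A := by
        rw [hmul]
        field_simp
  have hlog2 : Real.log 2 ≤ A := by
    linarith [Real.log_le_sub_one_of_pos (show (0 : ℝ) < 2 by norm_num)]
  have hmain : A * ((1 - ε) * Real.log t - Real.log lam) ≤ (lam + A) * L := by
    have := mul_le_mul_of_nonneg_left hLlow hA0.le
    nlinarith [mul_nonneg hlam.le hL0]
  rw [div_le_iff₀ hε] at hlog
  have := mul_le_mul_of_nonneg_left hlog hA0.le
  nlinarith

lemma tendsto_log_one_div_nhdsGT_zero :
    Tendsto (fun E : ℝ => Real.log (1 / E)) (nhdsWithin 0 (Set.Ioi 0)) atTop := by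
  simp only [one_div]
  exact Real.tendsto_log_atTop.comp tendsto_inv_nhdsGT_zero

lemma isBoundedUnder_capacity_ratio (hlam : 0 < lam) :
    IsBoundedUnder (· ≤ ·) (nhdsWithin 0 (Set.Ioi 0))
      (fun E : ℝ => (C_P lam E).toReal / (E * Real.log (Real.log (1 / E)))) := by
  refine ⟨|Real.log ((lam + 1) / lam)| + lam + 5, ?_⟩
  rw [eventually_map]
  filter_upwards [tendsto_log_one_div_nhdsGT_zero.eventually_ge_atTop (Real.exp 1),
    self_mem_nhdsWithin] with E hE hE0
  rw [Set.mem_Ioi] at hE0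
  have hT1 : 1 ≤ Real.log (1 / E) := le_trans (Real.one_le_exp zero_le_one) hE
  have hub := C_P_le hlam hE0 hT1
  set T := Real.log (1 / E) with hT
  have hlogT : 1 ≤ Real.log T := by
    rw [Real.le_log_iff_exp_le (by linarith)]
    exact hE
  have h1 : (C_P lam E).toReal ≤ (Real.log ((lam + T) / lam) + lam + 4) * E := by
    by_cases hbot : C_P lam E = ⊥
    · rw [hbot, EReal.toReal_bot]
      have : 0 ≤ Real.log ((lam + T) / lam) :=
        Real.log_nonneg (by rw [le_div_iff₀ hlam]; linarith)
      positivity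
    · have := EReal.toReal_le_toReal hub hbot (EReal.coe_ne_top _)
      rwa [EReal.toReal_coe] at this
  have h2 : Real.log ((lam + T) / lam) ≤ Real.log T + Real.log ((lam + 1) / lam) := by
    rw [← Real.log_mul (by positivity) (by positivity)]
    refine Real.log_le_log (by positivity) ?_
    rw [mul_div_assoc']
    gcongr
    nlinarith
  rw [div_le_iff₀ (by positivity)]
  have h3 : Real.log ((lam + T) / lam) + lam + 4 ≤
      (|Real.log ((lam + 1) / lam)| + lam + 5) * Real.log T := by
    have h4 := le_abs_self (Real.log ((lam + 1) / lam))
    nlinarith [mul_nonneg (show 0 ≤ |Real.log ((lam + 1) / lam)| + lam + 4 by positivity)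
      (sub_nonneg.2 hlogT)]
  nlinarith [mul_le_mul_of_nonneg_right h3 hE0.le]

lemma eventually_le_capacity_ratio (hlam : 0 < lam) {ε : ℝ} (hε : 0 < ε) (hε1 : ε < 1) :
    ∀ᶠ E : ℝ in nhdsWithin 0 (Set.Ioi 0),
      1 - 2 * ε ≤ (C_P lam E).toReal / (E * Real.log (Real.log (1 / E))) := by
  filter_upwards [tendsto_log_one_div_nhdsGT_zero.eventually
      (eventually_le_onOff_rate hlam hε hε1),
    tendsto_log_one_div_nhdsGT_zero.eventually_gt_atTop 1, self_mem_nhdsWithin]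
    with E ⟨hA1, hrate⟩ hT1 hE0
  rw [Set.mem_Ioi] at hE0
  set T := Real.log (1 / E) with hT
  set A := T ^ (1 - ε) with hA
  have hA0 : 0 < A := by linarith
  have hE1 : E < 1 := by
    by_contra! h
    have : T ≤ 0 := Real.log_nonpos (by positivity) ((div_le_one hE0).2 h)
    linarith
  have hp0 : 0 < E / A := by positivity
  have hp1 : E / A < 1 := by
    rw [div_lt_one hA0]
    linarith
  have hv : T ≤ Real.log (1 / (E / A)) := by
    refine Real.log_le_log (by positivity) (one_div_le_one_div_of_le hp0 ?_)
    exact div_le_self hE0.le hA1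
  have hcap := le_toReal_C_P hlam hE0 hT1.le hp0 hp1 hA0 (div_mul_cancel₀ E hA0.ne')
  have hlogT : 0 < Real.log T := Real.log_pos hT1
  rw [le_div_iff₀ (by positivity)]
  refine le_trans (le_of_eq ?_)
    ((mul_le_mul_of_nonneg_left (hrate _ hv) hp0.le).trans hcap)
  field_simp

end

theorem poisson_low_snr_capacity_lower {lam : ℝ} (hlam : 0 < lam) :
    1 ≤ Filter.liminf
      (fun E : ℝ => (C_P lam E).toReal / (E * Real.log (Real.log (1 / E))))
      (nhdsWithin 0 (Set.Ioi 0)) := by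
  refine le_of_forall_pos_sub_le fun δ hδ => ?_
  have hε : 0 < min (δ / 2) (1 / 2) := by positivity
  have hε1 : min (δ / 2) (1 / 2) < 1 := (min_le_right _ _).trans_lt (by norm_num)
  have h := le_liminf_of_le (isBoundedUnder_capacity_ratio hlam).isCoboundedUnder_ge
    (eventually_le_capacity_ratio hlam hε hε1)
  linarith [min_le_left (δ / 2) (1 / 2)]
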